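/- arXiv:2205.02527 — 2 statements merged into one kernel-verified Lean document; each statement's English description precedes it below -/
import Mathlib

section
/- Let N be an even natural number, x_1, …, x_N pairwise distinct reals, and for each 0 ≤ k ≤ N−1 let p_k ∈ ℝ[x] be a monic polynomial of degree k. Then (i) Pf_{i,j ∈ [N]}( sgn(x_i − x_j) ) = ∏_{1 ≤ i < j ≤ N} sgn(x_i − x_j), and consequently (ii) det_{i,j ∈ [N]}( p_{N−j}(x_i) ) · Pf_{i,j ∈ [N]}( sgn(x_i − x_j) ) = |Δ_N(X)|, i.e. the generalized β = 1 eigenvalue weight with kernel A(x,y) = sgn(x − y) reduces to the absolute Vandermonde |Δ_N(X)| = ∏_{1 ≤ i < j ≤ N} |x_i − x_j| of the orthogonal ensemble. -/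
/-- The Pfaffian of an `m × m` real matrix (intended for skew-symmetric matrices
with `m` even): `Pf M = (1/(2^n n!)) Σ_{σ} sgn(σ) ∏_{i=1}^{n} M_{σ(2i-1), σ(2i)}`
with `n = m / 2`. -/
noncomputable def pfaffian {m : ℕ} (M : Matrix (Fin m) (Fin m) ℝ) : ℝ :=
  ((2 : ℝ) ^ (m / 2) * (m / 2).factorial)⁻¹ *
    ∑ σ : Equiv.Perm (Fin m), ((Equiv.Perm.sign σ : ℤ) : ℝ) *
      ∏ i : Fin (m / 2),
        M (σ ⟨2 * (i : ℕ), by have := i.isLt; omega⟩)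
          (σ ⟨2 * (i : ℕ) + 1, by have := i.isLt; omega⟩)

open Equiv in
/-- The involution of `Fin m` exchanging `2k` and `2k + 1`, for even `m`. -/
def pairPerm {m : ℕ} (hm : Even m) : Perm (Fin m) :=
  Function.Involutive.toPerm
    (fun i => ⟨if (i : ℕ) % 2 = 0 then i + 1 else i - 1, by
      have := i.isLt; obtain ⟨k, rfl⟩ := hm; split_ifs <;> omega⟩)
    (fun i => by
      ext
      simp only
      split_ifs <;> omega)

theorem pairPerm_val {m : ℕ} (hm : Even m) (i : Fin m) :
    ((pairPerm hm i : Fin m) : ℕ) = if (i : ℕ) % 2 = 0 then (i : ℕ) + 1 else (i : ℕ) - 1 := rfl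

theorem pairPerm_pairPerm {m : ℕ} (hm : Even m) (i : Fin m) :
    pairPerm hm (pairPerm hm i) = i :=
  (pairPerm hm).left_inv i

theorem pairPerm_ne {m : ℕ} (hm : Even m) (i : Fin m) : pairPerm hm i ≠ i := by
  rw [Ne, Fin.ext_iff, pairPerm_val]
  split_ifs <;> omega

/-- The number of permutations commuting with `pairPerm`. -/
theorem card_commute_pairPerm {m : ℕ} (hm : Even m) :
    (Finset.univ.filter fun σ : Equiv.Perm (Fin m) =>
      ∀ a, σ (pairPerm hm (σ⁻¹ a)) = pairPerm hm a).card = 2 ^ (m / 2) * (m / 2).factorial := by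
  set t := pairPerm hm with ht
  have hpow : t ^ 2 = 1 := by
    ext i
    simp [pow_two, ht, pairPerm_pairPerm]
  have htwo : ∀ c ∈ t.cycleType, c = 2 :=
    (Equiv.Perm.pow_prime_eq_one_iff (p := 2)).1 hpow
  have hsupp : t.support = Finset.univ := by
    ext i
    simp [ht, pairPerm_ne]
  have hsum : t.cycleType.sum = m := by
    rw [Equiv.Perm.sum_cycleType, hsupp, Finset.card_univ, Fintype.card_fin]
  have hrep : t.cycleType = Multiset.replicate (m / 2) 2 := by
    have h := Multiset.eq_replicate_card.2 htwo
    rw [h, Multiset.sum_replicate, smul_eq_mul] at hsum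
    rw [h]
    congr 1
    omega
  have hcard := Equiv.Perm.nat_card_centralizer t
  rw [hsum, hrep] at hcard
  have hprod : ∏ n ∈ (Multiset.replicate (m / 2) 2).toFinset,
      ((Multiset.replicate (m / 2) 2).count n).factorial = (m / 2).factorial := by
    rcases Nat.eq_zero_or_pos (m / 2) with h | h
    · simp [h]
    · rw [Multiset.toFinset_replicate, if_neg h.ne']
      simp
  rw [hprod] at hcard
  simp only [Fintype.card_fin, Nat.sub_self, Nat.factorial_zero, one_mul,
    Multiset.prod_replicate] at hcard
  rw [← hcard, ← Fintype.card_subtype, ← Nat.card_eq_fintype_card]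
  refine Nat.card_congr (Equiv.subtypeEquivRight fun σ => ?_)
  rw [Subgroup.mem_centralizer_singleton_iff]
  constructor
  · intro h
    ext i
    simpa using congrArg Fin.val (h (σ i))
  · intro h a
    simpa using congrArg (fun τ : Equiv.Perm (Fin m) => τ (σ⁻¹ a)) h

/-- The skew-symmetric matrix with all entries above the diagonal equal to `1`. -/
def upperSign {m : ℕ} (i j : Fin m) : ℝ := if i < j then 1 else if j < i then -1 else 0

theorem upperSign_skew {m : ℕ} (i j : Fin m) : upperSign i j = -upperSign j i := by
  unfold upperSign
  split_ifs <;> first | omega | simp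

theorem upperSign_mul_self {m : ℕ} {i j : Fin m} (h : i ≠ j) :
    upperSign i j * upperSign i j = 1 := by
  unfold upperSign
  split_ifs <;> first | omega | simp

theorem upperSign_pairPerm {m : ℕ} (hm : Even m) {i j : Fin m} (h : i ≠ j)
    (h' : i ≠ pairPerm hm j) : upperSign i (pairPerm hm j) = upperSign i j := by
  rw [Ne, Fin.ext_iff] at h h'
  have := pairPerm_val hm j
  unfold upperSign
  simp only [Fin.lt_def]
  split_ifs at * <;> first | omega | rfl

theorem upperSign_swap {m : ℕ} (hm : Even m) {a u v : Fin m}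
    (h : u = a → v ≠ pairPerm hm a) (h' : u = pairPerm hm a → v ≠ a) :
    upperSign (Equiv.swap a (pairPerm hm a) u) (Equiv.swap a (pairPerm hm a) v) =
      upperSign u v := by
  have hta := pairPerm_pairPerm hm a
  have key : ∀ b w : Fin m, w ≠ b → w ≠ pairPerm hm b →
      upperSign (pairPerm hm b) w = upperSign b w := fun b w hb hb' => by
    rw [upperSign_skew, upperSign_pairPerm hm hb hb', ← upperSign_skew]
  by_cases huv : u = v
  · simp [huv, upperSign]
  rcases eq_or_ne u a with rfl | hua
  · rw [Equiv.swap_apply_left, Equiv.swap_apply_of_ne_of_ne (Ne.symm huv) (h rfl)]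
    exact key u v (Ne.symm huv) (h rfl)
  rcases eq_or_ne u (pairPerm hm a) with rfl | hut
  · rw [Equiv.swap_apply_right, Equiv.swap_apply_of_ne_of_ne (h' rfl) (Ne.symm huv)]
    exact (key a v (h' rfl) (Ne.symm huv)).symm
  rw [Equiv.swap_apply_of_ne_of_ne hua hut]
  rcases eq_or_ne v a with rfl | hva
  · rw [Equiv.swap_apply_left, upperSign_pairPerm hm hua hut]
  rcases eq_or_ne v (pairPerm hm a) with rfl | hvt
  · rw [Equiv.swap_apply_right, upperSign_pairPerm hm hua hut]
  · rw [Equiv.swap_apply_of_ne_of_ne hva hvt]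

/-- The summand of the Pfaffian of `M` attached to `σ`. -/
def pfaffianTerm {m : ℕ} (M : Fin m → Fin m → ℝ) (σ : Equiv.Perm (Fin m)) : ℝ :=
  ((Equiv.Perm.sign σ : ℤ) : ℝ) *
    ∏ i : Fin (m / 2),
      M (σ ⟨2 * (i : ℕ), by have := i.isLt; omega⟩)
        (σ ⟨2 * (i : ℕ) + 1, by have := i.isLt; omega⟩)

theorem pairPerm_two_mul {m : ℕ} (hm : Even m) (i : Fin (m / 2)) :
    (⟨2 * (i : ℕ) + 1, by have := i.isLt; omega⟩ : Fin m) =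
      pairPerm hm ⟨2 * (i : ℕ), by have := i.isLt; omega⟩ := by
  rw [Fin.ext_iff, pairPerm_val]
  simp

theorem pfaffianTerm_swap_mul {m : ℕ} (hm : Even m) (a : Fin m) (σ : Equiv.Perm (Fin m))
    (h : σ (pairPerm hm (σ⁻¹ a)) ≠ pairPerm hm a) :
    pfaffianTerm upperSign (Equiv.swap a (pairPerm hm a) * σ) = -pfaffianTerm upperSign σ := by
  have hprod : ∀ i : Fin (m / 2), upperSign
      ((Equiv.swap a (pairPerm hm a) * σ) ⟨2 * (i : ℕ), by have := i.isLt; omega⟩)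
      ((Equiv.swap a (pairPerm hm a) * σ) ⟨2 * (i : ℕ) + 1, by have := i.isLt; omega⟩) =
      upperSign (σ ⟨2 * (i : ℕ), by have := i.isLt; omega⟩)
        (σ ⟨2 * (i : ℕ) + 1, by have := i.isLt; omega⟩) := fun i => by
    rw [Equiv.Perm.mul_apply, Equiv.Perm.mul_apply, pairPerm_two_mul hm i]
    apply upperSign_swap
    · rintro rfl
      simpa using h
    · rintro h1 rfl
      apply h
      rw [← h1]
      simp [pairPerm_pairPerm]
  unfold pfaffianTerm
  rw [Finset.prod_congr rfl fun i _ => hprod i, Equiv.Perm.sign_mul,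
    Equiv.Perm.sign_swap (pairPerm_ne hm a).symm]
  simp

theorem sign_eq_prod_upperSign {m : ℕ} (σ : Equiv.Perm (Fin m)) :
    ((Equiv.Perm.sign σ : ℤ) : ℝ) =
      ∏ i, ∏ j ∈ Finset.Ioi i, upperSign (σ i) (σ j) := by
  rw [Equiv.Perm.prod_Ioi_comp_eq_sign_mul_prod σ upperSign_skew]
  rw [Finset.prod_eq_one (fun i _ => Finset.prod_eq_one fun j hj => ?_)]
  · simp
  · rw [upperSign, if_pos (Finset.mem_Ioi.1 hj)]

theorem pfaffianTerm_eq_one {m : ℕ} (hm : Even m) (σ : Equiv.Perm (Fin m))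
    (h : ∀ a, σ (pairPerm hm (σ⁻¹ a)) = pairPerm hm a) :
    pfaffianTerm upperSign σ = 1 := by
  have hcomm : ∀ i, σ (pairPerm hm i) = pairPerm hm (σ i) := fun i => by
    simpa using h (σ i)
  have hrow : ∀ i : Fin m, ∏ j ∈ (Finset.Ioi i).filter (fun j => j ≠ pairPerm hm i),
      upperSign (σ i) (σ j) = 1 := fun i => by
    refine Finset.prod_involution (fun j _ => pairPerm hm j) ?_ ?_ ?_ ?_
    · intro j hj
      obtain ⟨hj, hj'⟩ := Finset.mem_filter.1 hj
      have h1 : i ≠ j := (Finset.mem_Ioi.1 hj).ne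
      have h2 : i ≠ pairPerm hm j := by
        rintro rfl
        exact hj' (pairPerm_pairPerm hm j).symm
      rw [hcomm, upperSign_pairPerm hm (σ.injective.ne h1), upperSign_mul_self]
      · exact σ.injective.ne h1
      · rw [← hcomm]
        exact σ.injective.ne h2
    · intro j _ _
      exact pairPerm_ne hm j
    · intro j hj
      have := pairPerm_val hm j
      have := pairPerm_val hm i
      simp only [Finset.mem_filter, Finset.mem_Ioi, Fin.lt_def, Ne, Fin.ext_iff] at hj ⊢
      split_ifs at * <;> omega
    · intro j _
      exact pairPerm_pairPerm hm j
  have hrow' : ∀ i : Fin m, ∏ j ∈ Finset.Ioi i, upperSign (σ i) (σ j) =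
      if (i : ℕ) % 2 = 0 then upperSign (σ i) (σ (pairPerm hm i)) else 1 := fun i => by
    rw [← Finset.prod_filter_mul_prod_filter_not _ (fun j => j ≠ pairPerm hm i), hrow, one_mul]
    have hval := pairPerm_val hm i
    split_ifs at hval ⊢ with hi
    · rw [Finset.prod_eq_single_of_mem (pairPerm hm i)]
      · simp [Fin.lt_def, hval]
      · intro j hj hne
        simp [hne] at hj
    · refine Finset.prod_eq_one fun j hj => ?_
      simp only [Finset.mem_filter, Finset.mem_Ioi, not_not, Fin.lt_def] at hj
      obtain ⟨hj, rfl⟩ := hj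
      omega
  have hsign : ((Equiv.Perm.sign σ : ℤ) : ℝ) = ∏ i : Fin (m / 2),
      upperSign (σ ⟨2 * (i : ℕ), by have := i.isLt; omega⟩)
        (σ ⟨2 * (i : ℕ) + 1, by have := i.isLt; omega⟩) := by
    rw [sign_eq_prod_upperSign, Finset.prod_congr rfl fun i _ => hrow' i]
    symm
    refine Finset.prod_of_injOn
      (fun i : Fin (m / 2) => (⟨2 * (i : ℕ), by have := i.isLt; omega⟩ : Fin m)) ?_ ?_ ?_ ?_
    · intro i _ j _ hij
      simp only [Fin.mk.injEq] at hij
      ext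
      omega
    · intro i _
      simp
    · intro i _ hi
      rw [if_neg]
      intro h0
      refine hi ⟨⟨(i : ℕ) / 2, ?_⟩, by simp, ?_⟩
      · obtain ⟨k, rfl⟩ := hm
        have := i.isLt
        omega
      · ext
        simp only
        omega
    · intro i _
      rw [pairPerm_two_mul hm i]
      simp
  unfold pfaffianTerm
  rw [← hsign, ← Int.cast_mul, ← Units.val_mul, Int.units_mul_self]
  simp

theorem sum_pfaffianTerm_filter {m : ℕ} (hm : Even m) (K : Finset (Fin m)) :
    ∑ σ with ∀ a ∈ K, σ (pairPerm hm (σ⁻¹ a)) = pairPerm hm a, pfaffianTerm upperSign σ =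
      ∑ σ : Equiv.Perm (Fin m), pfaffianTerm upperSign σ := by
  induction K using Finset.induction_on with
  | empty => simp
  | insert a K _ ih =>
    rw [← ih, ← Finset.sum_filter_add_sum_filter_not
      (Finset.univ.filter fun σ : Equiv.Perm (Fin m) =>
        ∀ b ∈ K, σ (pairPerm hm (σ⁻¹ b)) = pairPerm hm b)
      (fun σ => σ (pairPerm hm (σ⁻¹ a)) = pairPerm hm a)]
    rw [Finset.filter_filter]
    have hzero : ∑ σ ∈ (Finset.univ.filter fun σ : Equiv.Perm (Fin m) =>
        ∀ b ∈ K, σ (pairPerm hm (σ⁻¹ b)) = pairPerm hm b) with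
        ¬ σ (pairPerm hm (σ⁻¹ a)) = pairPerm hm a, pfaffianTerm upperSign σ = 0 := by
      refine Finset.sum_involution (fun σ _ => Equiv.swap a (pairPerm hm a) * σ) ?_ ?_ ?_ ?_
      · intro σ hσ
        rw [pfaffianTerm_swap_mul hm a σ (Finset.mem_filter.1 hσ).2, add_neg_cancel]
      · intro σ _ _ heq
        exact pairPerm_ne hm a
          (Equiv.swap_eq_one_iff.1 (mul_eq_right.1 heq)).symm
      · intro σ hσ
        simp only [Finset.mem_filter, Finset.mem_univ, true_and, mul_inv_rev, Equiv.swap_inv,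
          Equiv.Perm.mul_apply] at hσ ⊢
        obtain ⟨hK, ha⟩ := hσ
        have hta : σ (pairPerm hm (σ⁻¹ (pairPerm hm a))) ≠ a := by
          intro h0
          apply ha
          have h1 : σ⁻¹ a = pairPerm hm (σ⁻¹ (pairPerm hm a)) :=
            Equiv.Perm.inv_eq_iff_eq.2 h0.symm
          rw [h1, pairPerm_pairPerm]
          simp
        refine ⟨fun b hb => ?_, ?_⟩
        · have h1 : b ≠ a := by
            rintro rfl
            exact ha (hK _ hb)
          have h2 : b ≠ pairPerm hm a := by
            rintro rfl
            exact hta ((hK _ hb).trans (pairPerm_pairPerm hm a))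
          rw [Equiv.swap_apply_of_ne_of_ne h1 h2, hK b hb, Equiv.swap_apply_of_ne_of_ne]
          · rintro rfl
            exact h2 (pairPerm_pairPerm hm b).symm
          · exact (pairPerm hm).injective.ne h1
        · rw [Equiv.swap_apply_left]
          intro h0
          exact hta ((Equiv.swap a (pairPerm hm a)).injective
            (h0.trans (Equiv.swap_apply_left a (pairPerm hm a)).symm))
      · intro σ _
        simp [← mul_assoc]
    rw [hzero, add_zero]
    refine Finset.sum_congr ?_ fun _ _ => rfl
    ext σ
    simp [and_comm]

theorem sum_pfaffianTerm_upperSign {m : ℕ} (hm : Even m) :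
    ∑ σ : Equiv.Perm (Fin m), pfaffianTerm upperSign σ = 2 ^ (m / 2) * (m / 2).factorial := by
  rw [← sum_pfaffianTerm_filter hm Finset.univ]
  simp only [Finset.mem_univ, forall_const]
  rw [Finset.sum_congr rfl fun σ hσ => pfaffianTerm_eq_one hm σ (Finset.mem_filter.1 hσ).2,
    Finset.sum_const, card_commute_pairPerm]
  simp

theorem pfaffian_upperSign {m : ℕ} (hm : Even m) :
    pfaffian (Matrix.of (upperSign (m := m))) = 1 := by
  have h := sum_pfaffianTerm_upperSign hm
  unfold pfaffianTerm at h
  unfold pfaffian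
  simp only [Matrix.of_apply]
  rw [h]
  exact inv_mul_cancel₀ (by positivity)

theorem pfaffian_submatrix_perm {m : ℕ} (M : Matrix (Fin m) (Fin m) ℝ)
    (π : Equiv.Perm (Fin m)) :
    pfaffian (M.submatrix π π) = ((Equiv.Perm.sign π : ℤ) : ℝ) * pfaffian M := by
  unfold pfaffian
  rw [mul_left_comm]
  congr 1
  conv_rhs => rw [← Equiv.sum_comp (Equiv.mulLeft π), Finset.mul_sum]
  refine Finset.sum_congr rfl fun σ _ => ?_
  have hsq : ((Equiv.Perm.sign π : ℤ) : ℝ) * ((Equiv.Perm.sign π : ℤ) : ℝ) = 1 := by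
    rw [← Int.cast_mul, ← Units.val_mul, Int.units_mul_self]
    simp
  simp only [Matrix.submatrix_apply, Equiv.coe_mulLeft, Equiv.Perm.mul_apply,
    Equiv.Perm.sign_mul, Units.val_mul, Int.cast_mul]
  rw [← mul_assoc, ← mul_assoc, hsq, one_mul]

theorem exists_perm_sign_sub_eq {m : ℕ} {x : Fin m → ℝ} (hx : Function.Injective x) :
    ∃ π : Equiv.Perm (Fin m), ∀ i j, Real.sign (x i - x j) = upperSign (π i) (π j) := by
  set τ := Tuple.sort fun i => -x i with hτ
  have hmono : StrictMono ((fun i => -x i) ∘ τ) :=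
    (Tuple.monotone_sort fun i => -x i).strictMono_of_injective
      ((neg_injective.comp hx).comp τ.injective)
  have hlt : ∀ i j, τ⁻¹ i < τ⁻¹ j ↔ x j < x i := fun i j => by
    rw [← hmono.lt_iff_lt]
    simp
  refine ⟨τ⁻¹, fun i j => ?_⟩
  unfold upperSign
  simp only [hlt]
  rcases lt_trichotomy (x i) (x j) with h | h | h
  · rw [Real.sign_of_neg (sub_neg.2 h), if_neg h.not_gt, if_pos h]
  · simp [h]
  · rw [Real.sign_of_pos (sub_pos.2 h), if_pos h]

theorem pfaffian_sign_sub {m : ℕ} (hm : Even m) {x : Fin m → ℝ} (hx : Function.Injective x) :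
    pfaffian (Matrix.of fun i j : Fin m => Real.sign (x i - x j)) =
      ∏ i : Fin m, ∏ j ∈ Finset.Ioi i, Real.sign (x i - x j) := by
  obtain ⟨π, hπ⟩ := exists_perm_sign_sub_eq hx
  simp only [hπ]
  rw [← sign_eq_prod_upperSign, ← mul_one ((_ : ℤ) : ℝ), ← pfaffian_upperSign hm,
    ← pfaffian_submatrix_perm]
  rfl

theorem det_eval_monic_rev {N : ℕ} (x : Fin N → ℝ) (p : ℕ → Polynomial ℝ)
    (hmonic : ∀ k < N, (p k).Monic) (hdeg : ∀ k < N, (p k).natDegree = k) :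
    Matrix.det (Matrix.of fun i j : Fin N => (p (N - 1 - (j : ℕ))).eval (x i)) =
      ∏ i : Fin N, ∏ j ∈ Finset.Ioi i, (x i - x j) := by
  have hprod : ∀ f : Fin N → Fin N → ℝ, ∏ i, ∏ j ∈ Finset.Ioi i, f i j =
      ∏ i, ∏ j, if i < j then f i j else 1 := fun f =>
    Finset.prod_congr rfl fun i _ => by
      rw [← Finset.prod_filter]
      congr 1
      ext
      simp
  rw [← Matrix.det_submatrix_equiv_self Fin.revPerm]
  trans (Matrix.vandermonde (x ∘ Fin.rev)).det
  · rw [Matrix.det_eval_matrixOfPolynomials_eq_det_vandermonde (x ∘ Fin.rev)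
      (fun i => p i) (fun i => hdeg i i.isLt) (fun i => hmonic i i.isLt)]
    congr 1
    ext i j
    have : N - 1 - ((Fin.rev j : Fin N) : ℕ) = j := by
      rw [Fin.val_rev]
      omega
    simp only [Matrix.submatrix_apply, Matrix.of_apply, Fin.revPerm_apply, this,
      Function.comp_apply]
  · rw [Matrix.det_vandermonde, hprod, hprod, Finset.prod_comm,
      ← Equiv.prod_comp Fin.revPerm]
    refine Finset.prod_congr rfl fun i _ => ?_
    rw [← Equiv.prod_comp Fin.revPerm]
    refine Finset.prod_congr rfl fun j _ => ?_
    simp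

/-- **Specialization of the generalized β = 1 model to the orthogonal ensemble.**
For even `N`, pairwise distinct `x_i` and monic polynomials `p_k` of degree `k`:
(i) `Pf (sgn(x_i - x_j)) = ∏_{i<j} sgn(x_i - x_j)`, and
(ii) `det (p_{N-j}(x_i)) · Pf (sgn(x_i - x_j)) = ∏_{i<j} |x_i - x_j| = |Δ_N(X)|`. -/
theorem stmt_12 (N : ℕ) (hN : Even N) (x : Fin N → ℝ) (hx : Function.Injective x)
    (p : ℕ → Polynomial ℝ)
    (hmonic : ∀ k < N, (p k).Monic) (hdeg : ∀ k < N, (p k).natDegree = k) :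
    pfaffian (Matrix.of fun i j : Fin N => Real.sign (x i - x j))
        = (∏ i : Fin N, ∏ j ∈ Finset.Ioi i, Real.sign (x i - x j)) ∧
      Matrix.det (Matrix.of fun i j : Fin N => (p (N - 1 - (j : ℕ))).eval (x i)) *
          pfaffian (Matrix.of fun i j : Fin N => Real.sign (x i - x j))
        = ∏ i : Fin N, ∏ j ∈ Finset.Ioi i, |x i - x j| := by
  refine ⟨pfaffian_sign_sub hN hx, ?_⟩
  rw [pfaffian_sign_sub hN hx, det_eval_monic_rev x p hmonic hdeg, ← Finset.prod_mul_distrib]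
  refine Finset.prod_congr rfl fun i _ => ?_
  rw [← Finset.prod_mul_distrib]
  refine Finset.prod_congr rfl fun j _ => ?_
  rcases lt_trichotomy (x i - x j) 0 with h | h | h
  · rw [Real.sign_of_neg h, abs_of_neg h, mul_neg_one]
  · simp [h]
  · rw [Real.sign_of_pos h, abs_of_pos h, mul_one]
end

section
/- (Schur polynomial average of the β = 1 model) Let (E, μ) be a measure space with E ⊆ ℝ, N an even natural number, A : E × E → ℝ a measurable skew-symmetric kernel, and λ a partition with at most N parts; assume all products of monomials x^{λ_i + N − i} against A appearing below are integrable. Then (1/N!) ∫_{E^N} det_{i,j ∈ [N]}( x_i^{λ_j + N − j} ) · Pf_{i,j ∈ [N]}( A(x_i, x_j) ) dμ^N = Pf_{i,j ∈ [N]} ( ∫∫ x^{λ_i + N − i} A(x,y) y^{λ_j + N − j} dμ(x) dμ(y) ). Equivalently, since det_{i,j}(x_i^{λ_j + N − j}) = s_λ(X) Δ_N(X), the Schur polynomial average in the generalized β = 1 model with weight Δ_N(X) Pf A(x_i,x_j) satisfies 𝒵_N^{(1)} · ⟨s_λ(X)⟩₁ = Pf_{i,j ∈ [N]}( ⟨x^{λ_i+N−i}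 | A | x^{λ_j+N−j}⟩ ), where 𝒵_N^{(1)} = (1/N!) ∫ Δ_N(X) Pf_{i,j}(A(x_i,x_j)) dμ^N. -/
open MeasureTheory

/-- Grouping the coordinates of `ι → α` into pairs along an equivalence `κ × Fin 2 ≃ ι`. -/
def pairingEquiv {ι κ α : Type*} [MeasurableSpace α] (e : κ × Fin 2 ≃ ι) :
    (κ → α × α) ≃ᵐ (ι → α) where
  toFun y i := if (e.symm i).2 = 0 then (y (e.symm i).1).1 else (y (e.symm i).1).2
  invFun x k := (x (e (k, 0)), x (e (k, 1)))
  left_inv y := by ext k <;> simp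
  right_inv x := by
    ext i
    obtain ⟨⟨k, j⟩, rfl⟩ := e.surjective i
    fin_cases j <;> simp
  measurable_toFun := by
    refine measurable_pi_lambda _ fun i => ?_
    dsimp
    split_ifs <;> fun_prop
  measurable_invFun := by
    dsimp
    fun_prop

section Pairing

variable {ι κ α : Type*} [Fintype ι] [Fintype κ] [MeasurableSpace α]

lemma prod_eq_prod_pairs {M : Type*} [CommMonoid M] (e : κ × Fin 2 ≃ ι) (h : ι → M) :
    ∏ i, h i = ∏ k, h (e (k, 0)) * h (e (k, 1)) := by
  rw [← e.prod_comp, Fintype.prod_prod_type]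
  simp [Fin.prod_univ_two]

lemma measurePreserving_pairingEquiv (μ : Measure α) [SigmaFinite μ] (e : κ × Fin 2 ≃ ι) :
    MeasurePreserving (pairingEquiv e) (Measure.pi fun _ : κ => μ.prod μ)
      (Measure.pi fun _ : ι => μ) := by
  refine ⟨(pairingEquiv e).measurable, (Measure.pi_eq fun s _ => ?_).symm⟩
  have hpre : pairingEquiv e ⁻¹' Set.pi Set.univ s =
      Set.pi Set.univ fun k => s (e (k, 0)) ×ˢ s (e (k, 1)) := by
    ext y
    simp [Set.mem_pi, pairingEquiv, ← e.forall_congr_right, forall_and]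
  rw [MeasurableEquiv.map_apply, hpre, Measure.pi_pi, prod_eq_prod_pairs e]
  simp [Measure.prod_prod]

lemma integrable_prod_pairs (μ : Measure α) [SigmaFinite μ] (e : κ × Fin 2 ≃ ι)
    (g : κ → α × α → ℝ) (hg : ∀ k, Integrable (g k) (μ.prod μ)) :
    Integrable (fun x : ι → α => ∏ k, g k (x (e (k, 0)), x (e (k, 1))))
      (Measure.pi fun _ => μ) :=
  ((measurePreserving_pairingEquiv μ e).symm.integrable_comp_emb
    (pairingEquiv e).symm.measurableEmbedding).2 (Integrable.fintype_prod hg)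

lemma integral_prod_pairs (μ : Measure α) [SigmaFinite μ] (e : κ × Fin 2 ≃ ι)
    (g : κ → α × α → ℝ) :
    ∫ x : ι → α, ∏ k, g k (x (e (k, 0)), x (e (k, 1))) ∂(Measure.pi fun _ => μ) =
      ∏ k, ∫ p, g k p ∂(μ.prod μ) := by
  rw [← integral_fintype_prod_eq_prod]
  exact (measurePreserving_pairingEquiv μ e).symm.integral_comp'
    (fun y : κ → α × α => ∏ k, g k (y k))

end Pairing

/-- The equivalence sending `(k, j)` to `2 * k + j`. -/
def evenPairs {N : ℕ} (hN : Even N) : Fin (N / 2) × Fin 2 ≃ Fin N :=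
  finProdFinEquiv.trans (finCongr (Nat.div_two_mul_two_of_even hN))

lemma pfaffian_eq_sum_evenPairs {N : ℕ} (hN : Even N) (M : Matrix (Fin N) (Fin N) ℝ) :
    pfaffian M = ((2 : ℝ) ^ (N / 2) * (N / 2).factorial)⁻¹ *
      ∑ σ : Equiv.Perm (Fin N), ((Equiv.Perm.sign σ : ℤ) : ℝ) *
        ∏ k, M (σ (evenPairs hN (k, 0))) (σ (evenPairs hN (k, 1))) := by
  unfold pfaffian
  congr! 6 with σ _ k <;> ext <;> simp [evenPairs, add_comm]

/-- **De Bruijn's integration formula** for the Pfaffian of a kernel. -/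
lemma integral_det_mul_pfaffian {α : Type*} [MeasurableSpace α] (μ : Measure α) [SigmaFinite μ]
    {N : ℕ} (hN : Even N) (A : α → α → ℝ) (f : Fin N → α → ℝ)
    (hint : ∀ i j, Integrable (fun p : α × α => f i p.1 * A p.1 p.2 * f j p.2) (μ.prod μ)) :
    ∫ x : Fin N → α, Matrix.det (Matrix.of fun i j => f j (x i)) *
        pfaffian (Matrix.of fun i j => A (x i) (x j)) ∂(Measure.pi fun _ => μ) =
      N.factorial *
        pfaffian (Matrix.of fun i j => ∫ u, ∫ v, f i u * A u v * f j v ∂μ ∂μ) := by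
  set e := evenPairs hN
  let g (i j : Fin N) (p : α × α) : ℝ := f i p.1 * A p.1 p.2 * f j p.2
  let c : ℝ := ((2 : ℝ) ^ (N / 2) * (N / 2).factorial)⁻¹
  have hexpand (x : Fin N → α) : Matrix.det (Matrix.of fun i j => f j (x i)) *
      pfaffian (Matrix.of fun i j => A (x i) (x j)) =
      c * ∑ σ : Equiv.Perm (Fin N), ∑ ρ : Equiv.Perm (Fin N), ((Equiv.Perm.sign ρ : ℤ) : ℝ) *
        ∏ k, g (ρ (e (k, 0))) (ρ (e (k, 1)))
          (x ((e.trans σ) (k, 0)), x ((e.trans σ) (k, 1))) := by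
    rw [pfaffian_eq_sum_evenPairs hN, mul_left_comm, Finset.mul_sum]
    congr 1
    refine Finset.sum_congr rfl fun σ _ => ?_
    rw [← Matrix.det_transpose, Matrix.det_apply', Finset.sum_mul]
    refine Fintype.sum_equiv (Equiv.mulRight σ) _ _ fun τ => ?_
    rw [prod_eq_prod_pairs (e.trans σ)]
    have hsign : ((Equiv.Perm.sign (τ * σ) : ℤ) : ℝ) =
        ((Equiv.Perm.sign τ : ℤ) : ℝ) * ((Equiv.Perm.sign σ : ℤ) : ℝ) := by simp
    rw [Equiv.coe_mulRight, hsign, mul_mul_mul_comm, ← Finset.prod_mul_distrib]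
    congr 1
    refine Finset.prod_congr rfl fun k _ => ?_
    simp only [Matrix.transpose_apply, Matrix.of_apply, Equiv.trans_apply, Equiv.Perm.mul_apply,
      g, e]
    ring
  have hintegrable (σ ρ : Equiv.Perm (Fin N)) := integrable_prod_pairs μ (e.trans σ)
    (fun k => g (ρ (e (k, 0))) (ρ (e (k, 1)))) fun k => hint _ _
  simp_rw [hexpand]
  rw [integral_const_mul, integral_finsetSum _ fun σ _ =>
    integrable_finsetSum _ fun ρ _ => (hintegrable σ ρ).const_mul _]
  simp_rw [integral_finsetSum Finset.univ fun ρ _ => (hintegrable _ ρ).const_mul _,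
    integral_const_mul]
  simp_rw [integral_prod_pairs]
  rw [Finset.sum_const, Finset.card_univ, Fintype.card_perm, Fintype.card_fin, nsmul_eq_mul,
    pfaffian_eq_sum_evenPairs hN, mul_left_comm]
  congr! 5 with ρ _ k
  exact integral_prod _ (hint _ _)

/-- **Schur polynomial average of the generalized β = 1 model.**
For even `N`, a skew-symmetric kernel `A` and a partition `l` with at most `N` parts
(nonincreasing, padded with zeros, exponents `l_j + N - j` in 1-indexed notation):
`(1/N!) ∫ det(x_i^{l_j + N - j}) Pf(A(x_i,x_j)) dμ^N`
`= Pf (∫∫ x^{l_i + N - i} A(x,y) y^{l_j + N - j} dμ dμ)`,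
i.e. `𝒵_N^{(1)} ⟨s_l(X)⟩₁ = Pf (⟨x^{l_i+N-i} | A | x^{l_j+N-j}⟩)`. -/
theorem stmt_15 (μ : Measure ℝ) [SigmaFinite μ] (N : ℕ) (hN : Even N)
    (A : ℝ → ℝ → ℝ) (hA : Measurable (Function.uncurry A))
    (hskew : ∀ x y, A y x = -A x y)
    (l : Fin N → ℕ) (hl : Antitone l)
    (hint : ∀ i j : Fin N,
      Integrable (fun p : ℝ × ℝ =>
        p.1 ^ (l i + (N - 1 - (i : ℕ))) * A p.1 p.2 * p.2 ^ (l j + (N - 1 - (j : ℕ))))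
        (μ.prod μ)) :
    ((N.factorial : ℝ))⁻¹ *
      ∫ x : Fin N → ℝ,
        Matrix.det (Matrix.of fun i j : Fin N => x i ^ (l j + (N - 1 - (j : ℕ)))) *
          pfaffian (Matrix.of fun i j : Fin N => A (x i) (x j))
        ∂(Measure.pi fun _ => μ)
      = pfaffian (Matrix.of fun i j : Fin N =>
          ∫ u, ∫ v, u ^ (l i + (N - 1 - (i : ℕ))) * A u v * v ^ (l j + (N - 1 - (j : ℕ))) ∂μ ∂μ) := by
  rw [integral_det_mul_pfaffian μ hN A (fun j u => u ^ (l j + (N - 1 - (j : ℕ)))) hint,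
    inv_mul_cancel_left₀ (by positivity)]
end
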